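/- In the cyclotomic BMW algebra B_n^k(R), for every integer p and every 1 ≤ i ≤ n−1: (I) e_i(Y_i')^p e_i lies in the R-span of the elements Y^{s₁}(Y₂')^{s₂}⋯(Y_{i−1}')^{s_{i−1}} e_i with s₁, …, s_{i−1} ∈ ℤ; (II) X_i(Y_i')^p e_i lies in the R-span of the elements Y^{s₁}(Y₂')^{s₂}⋯(Y_{i−1}')^{s_{i−1}}(Y_i')^{s_i} e_i with s₁, …, s_i ∈ ℤ and |s_i| ≤ |p|; (III) e_i(Y_i')^p X_i lies in the R-span of the elements e_iY^{s₁}(Y₂')^{s₂}⋯(Y_{i−1}')^{s_{i−1}}(Y_i')^{s_i} with s₁, …, s_i ∈ ℤ and |s_i| ≤ |p|. -/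

import Mathlib

/-!
Cyclotomic BMW algebra `B_n^k(R)`, presented as the quotient of the free `R`-algebra on
generators `Y, Y⁻¹, Xᵢ, Xᵢ⁻¹ (1 ≤ i ≤ n-1), eᵢ (1 ≤ i ≤ n-1)` by the defining relations.
Generators with out-of-range indices are identified with `1` (resp. `0` for the `eᵢ`),
so that the quotient is exactly the cyclotomic BMW algebra.
-/

inductive BMWGen : Type
  | Y : BMWGen
  | Yinv : BMWGen
  | X : ℕ → BMWGen
  | Xinv : ℕ → BMWGen
  | E : ℕ → BMWGen

namespace CBMW

/-- The parameters of a cyclotomic BMW algebra: `n`, `k`, units `q, λ, q₀` and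
families `qc` (the `qᵢ`, with `qc 0 = q₀`) and `A` (the `Aᵢ`). -/
structure Params (R : Type) [CommRing R] where
  n : ℕ
  k : ℕ
  q : Rˣ
  lam : Rˣ
  q0 : Rˣ
  qc : ℕ → R
  A : ℕ → R

variable {R : Type} [CommRing R]

abbrev F (R : Type) [CommRing R] := FreeAlgebra R BMWGen

def fY : F R := FreeAlgebra.ι R BMWGen.Y
def fYi : F R := FreeAlgebra.ι R BMWGen.Yinv
def fX (i : ℕ) : F R := FreeAlgebra.ι R (BMWGen.X i)
def fXi (i : ℕ) : F R := FreeAlgebra.ι R (BMWGen.Xinv i)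
def fE (i : ℕ) : F R := FreeAlgebra.ι R (BMWGen.E i)

/-- `δ = q - q⁻¹`. -/
def Params.delta (P : Params R) : R := (P.q : R) - ((P.q⁻¹ : Rˣ) : R)

/-- `λ⁻¹` as an element of `R`. -/
def Params.laminv (P : Params R) : R := ((P.lam⁻¹ : Rˣ) : R)

/-- The defining relations of the cyclotomic BMW algebra. -/
inductive Rel (P : Params R) : F R → F R → Prop
  | X_inv_right {i : ℕ} (h1 : 1 ≤ i) (h2 : i ≤ P.n - 1) : Rel P (fX i * fXi i) 1
  | X_inv_left {i : ℕ} (h1 : 1 ≤ i) (h2 : i ≤ P.n - 1) : Rel P (fXi i * fX i) 1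
  | Y_inv_right : Rel P (fY * fYi) 1
  | Y_inv_left : Rel P (fYi * fY) 1
  | X_invalid {i : ℕ} (h : i = 0 ∨ P.n - 1 < i) : Rel P (fX i) 1
  | Xi_invalid {i : ℕ} (h : i = 0 ∨ P.n - 1 < i) : Rel P (fXi i) 1
  | E_invalid {i : ℕ} (h : i = 0 ∨ P.n - 1 < i) : Rel P (fE i) 0
  | skein {i : ℕ} (h1 : 1 ≤ i) (h2 : i ≤ P.n - 1) :
      Rel P (fX i - fXi i) (P.delta • ((1 : F R) - fE i))
  | XX_far {i j : ℕ} (h1 : 1 ≤ i) (h2 : i ≤ P.n - 1) (h3 : 1 ≤ j) (h4 : j ≤ P.n - 1)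
      (h : i + 2 ≤ j ∨ j + 2 ≤ i) : Rel P (fX i * fX j) (fX j * fX i)
  | braid {i : ℕ} (h1 : 1 ≤ i) (h2 : i + 1 ≤ P.n - 1) :
      Rel P (fX i * fX (i+1) * fX i) (fX (i+1) * fX i * fX (i+1))
  | XE_far {i j : ℕ} (h1 : 1 ≤ i) (h2 : i ≤ P.n - 1) (h3 : 1 ≤ j) (h4 : j ≤ P.n - 1)
      (h : i + 2 ≤ j ∨ j + 2 ≤ i) : Rel P (fX i * fE j) (fE j * fX i)
  | EE_far {i j : ℕ} (h1 : 1 ≤ i) (h2 : i ≤ P.n - 1) (h3 : 1 ≤ j) (h4 : j ≤ P.n - 1)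
      (h : i + 2 ≤ j ∨ j + 2 ≤ i) : Rel P (fE i * fE j) (fE j * fE i)
  | untwist_right {i : ℕ} (h1 : 1 ≤ i) (h2 : i ≤ P.n - 1) :
      Rel P (fX i * fE i) ((P.lam : R) • fE i)
  | untwist_left {i : ℕ} (h1 : 1 ≤ i) (h2 : i ≤ P.n - 1) :
      Rel P (fE i * fX i) ((P.lam : R) • fE i)
  | XXE {i j : ℕ} (h1 : 1 ≤ i) (h2 : i ≤ P.n - 1) (h3 : 1 ≤ j) (h4 : j ≤ P.n - 1)
      (h : j = i + 1 ∨ i = j + 1) : Rel P (fX i * fX j * fE i) (fE j * fE i)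
  | EXX {i j : ℕ} (h1 : 1 ≤ i) (h2 : i ≤ P.n - 1) (h3 : 1 ≤ j) (h4 : j ≤ P.n - 1)
      (h : j = i + 1 ∨ i = j + 1) : Rel P (fE j * fE i) (fE j * fX i * fX j)
  | EEE_up {i : ℕ} (h1 : 1 ≤ i) (h2 : i + 1 ≤ P.n - 1) :
      Rel P (fE i * fE (i+1) * fE i) (fE i)
  | EEE_down {i : ℕ} (h1 : 1 ≤ i) (h2 : i + 1 ≤ P.n - 1) :
      Rel P (fE (i+1) * fE i * fE (i+1)) (fE (i+1))
  | E_sq {i : ℕ} (h1 : 1 ≤ i) (h2 : i ≤ P.n - 1) : Rel P (fE i * fE i) (P.A 0 • fE i)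
  | cyclo : Rel P (fY ^ P.k) (∑ i ∈ Finset.range P.k, P.qc i • fY ^ i)
  | braidB (h : 2 ≤ P.n) :
      Rel P (fX 1 * fY * fX 1 * fY) (fY * fX 1 * fY * fX 1)
  | YX_comm {i : ℕ} (h1 : 2 ≤ i) (h2 : i ≤ P.n - 1) : Rel P (fY * fX i) (fX i * fY)
  | YE_comm {i : ℕ} (h1 : 2 ≤ i) (h2 : i ≤ P.n - 1) : Rel P (fY * fE i) (fE i * fY)
  | YXYE (h : 2 ≤ P.n) : Rel P (fY * fX 1 * fY * fE 1) (P.laminv • fE 1)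
  | EYXY (h : 2 ≤ P.n) : Rel P (fE 1 * (fY * fX 1 * fY)) (P.laminv • fE 1)
  | EYE {m : ℕ} (h : 2 ≤ P.n) (hm : m ≤ P.k - 1) :
      Rel P (fE 1 * fY ^ m * fE 1) (P.A m • fE 1)

/-- The cyclotomic BMW algebra `B_n^k(R)`. -/
abbrev Alg (P : Params R) := RingQuot (Rel P)

def pr (P : Params R) : F R →ₐ[R] Alg P := RingQuot.mkAlgHom R (Rel P)

/-- The generator `Y`. -/
def Yg (P : Params R) : Alg P := pr P fY
/-- The generator `Y⁻¹`. -/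
def Ygi (P : Params R) : Alg P := pr P fYi
/-- The generator `Xᵢ`. -/
def Xg (P : Params R) (i : ℕ) : Alg P := pr P (fX i)
/-- The generator `Xᵢ⁻¹`. -/
def Xgi (P : Params R) (i : ℕ) : Alg P := pr P (fXi i)
/-- The generator `eᵢ`. -/
def Eg (P : Params R) (i : ℕ) : Alg P := pr P (fE i)

/-- `X₁ X₂ ⋯ X_m`. -/
def upX (P : Params R) : ℕ → Alg P
  | 0 => 1
  | m + 1 => upX P m * Xg P (m + 1)

/-- `X_m ⋯ X₂ X₁`. -/
def downX (P : Params R) : ℕ → Alg P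
  | 0 => 1
  | m + 1 => Xg P (m + 1) * downX P m

/-- `X₁⁻¹ X₂⁻¹ ⋯ X_m⁻¹`. -/
def upXi (P : Params R) : ℕ → Alg P
  | 0 => 1
  | m + 1 => upXi P m * Xgi P (m + 1)

/-- `X_m⁻¹ ⋯ X₂⁻¹ X₁⁻¹`. -/
def downXi (P : Params R) : ℕ → Alg P
  | 0 => 1
  | m + 1 => Xgi P (m + 1) * downXi P m

/-- `Yᵢ' = X_{i-1} ⋯ X₁ Y X₁ ⋯ X_{i-1}`. -/
def Yp (P : Params R) (i : ℕ) : Alg P := downX P (i - 1) * Yg P * upX P (i - 1)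

/-- `(Yᵢ')⁻¹ = X_{i-1}⁻¹ ⋯ X₁⁻¹ Y⁻¹ X₁⁻¹ ⋯ X_{i-1}⁻¹`. -/
def YpInv (P : Params R) (i : ℕ) : Alg P := downXi P (i - 1) * Ygi P * upXi P (i - 1)

/-- `(Yᵢ')^p` for an integer exponent `p`. -/
def Ypow (P : Params R) (i : ℕ) (p : ℤ) : Alg P :=
  if 0 ≤ p then Yp P i ^ p.toNat else YpInv P i ^ (-p).toNat

/-- `Y^{s 1} (Y₂')^{s 2} ⋯ (Y_m')^{s m}`. -/
def YpowProd (P : Params R) (s : ℕ → ℤ) : ℕ → Alg P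
  | 0 => 1
  | m + 1 => YpowProd P s m * Ypow P (m + 1) (s (m + 1))

/-- The subalgebra `B_l` generated by `Y^{±1}, X₁^{±1}, …, X_{l-1}^{±1}, e₁, …, e_{l-1}`. -/
def Bsub (P : Params R) (l : ℕ) : Subalgebra R (Alg P) :=
  Algebra.adjoin R
    ({Yg P, Ygi P} ∪
      {x | ∃ i, 1 ≤ i ∧ i + 1 ≤ l ∧ (x = Xg P i ∨ x = Xgi P i ∨ x = Eg P i)})

/-- `α_{ijl}^p = (Yᵢ')^p Xᵢ ⋯ X_{j-1} e_j ⋯ e_l`. -/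
def alpha (P : Params R) (i j l : ℕ) (p : ℤ) : Alg P :=
  Ypow P i p * ((List.range' i (j - i)).map fun t => Xg P t).prod *
    ((List.range' j (l + 1 - j)).map fun t => Eg P t).prod

/-- The set `P = {⌊k/2⌋ - (k-1), …, ⌊k/2⌋}` of `k` consecutive integers. -/
def Pset (k : ℕ) : Set ℤ := {p | (↑(k / 2) : ℤ) - ((k : ℤ) - 1) ≤ p ∧ p ≤ (↑(k / 2) : ℤ)}

/-- `α_{i₁,j₁,l-1}^{s₁} ⋯ α_{i_m,j_m,l-2m+1}^{s_m}`. -/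
def alphaChain (P : Params R) (l : ℕ) (ii jj : ℕ → ℕ) (ss : ℕ → ℤ) : ℕ → Alg P
  | 0 => 1
  | m + 1 => alphaChain P l ii jj ss m *
      alpha P (ii (m + 1)) (jj (m + 1)) (l + 1 - 2 * (m + 1)) (ss (m + 1))

/-- `α_{i₁,j₁,l-2}^{s₁} ⋯ α_{i_m,j_m,l-2m}^{s_m}`. -/
def alphaChainBar (P : Params R) (l : ℕ) (ii jj : ℕ → ℕ) (ss : ℕ → ℤ) : ℕ → Alg P
  | 0 => 1
  | m + 1 => alphaChainBar P l ii jj ss m *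
      alpha P (ii (m + 1)) (jj (m + 1)) (l - 2 * (m + 1)) (ss (m + 1))

/-- `E_{l,m} = e_{l-1} e_{l-3} ⋯ e_{l-2m+1}`. -/
def Echain (P : Params R) (l : ℕ) : ℕ → Alg P
  | 0 => 1
  | m + 1 => Echain P l m * Eg P (l + 1 - 2 * (m + 1))

/-- The set `V_{l,m}^g`. -/
def Vg (P : Params R) (l m : ℕ) : Set (Alg P) :=
  {x | ∃ ii jj : ℕ → ℕ, ∃ ss : ℕ → ℤ,
    (∀ t, 1 ≤ t → t ≤ m →
      1 ≤ ii t ∧ ii t ≤ jj t ∧ jj t ≤ l + 1 - 2 * t ∧ ss t ∈ Pset P.k) ∧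
    x = alphaChain P l ii jj ss m}

/-- The set `V_{l,m}`. -/
def V (P : Params R) (l m : ℕ) : Set (Alg P) :=
  {x | ∃ ii jj : ℕ → ℕ, ∃ ss : ℕ → ℤ,
    (∀ t, 1 ≤ t → t ≤ m →
      1 ≤ ii t ∧ ii t ≤ jj t ∧ jj t ≤ l + 1 - 2 * t ∧ ss t ∈ Pset P.k) ∧
    (∀ t, 1 ≤ t → t + 1 ≤ m → ii (t + 1) < ii t) ∧
    x = alphaChain P l ii jj ss m}

/-- The set `V̄_{l,m}`. -/
def Vbar (P : Params R) (l m : ℕ) : Set (Alg P) :=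
  {x | ∃ ii jj : ℕ → ℕ, ∃ ss : ℕ → ℤ,
    (∀ t, 1 ≤ t → t ≤ m →
      1 ≤ ii t ∧ ii t ≤ jj t ∧ jj t ≤ l + 1 - 2 * t ∧ ss t ∈ Pset P.k) ∧
    (∀ t, 1 ≤ t → t + 1 ≤ m → ii (t + 1) < ii t) ∧
    x = alphaChainBar P l ii jj ss m}

end CBMW

namespace CBMW

section Abstract

variable {R A : Type*} [CommRing R] [Ring A] [Algebra R A]

/-- The left `C`-module `C e` as an `R`-submodule. -/
def leftMul (C : Subalgebra R A) (e : A) : Submodule R A :=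
  (Subalgebra.toSubmodule C).map (LinearMap.mulRight R e)

lemma mem_leftMul {C : Subalgebra R A} {e x : A} :
    x ∈ leftMul C e ↔ ∃ c ∈ C, c * e = x := by
  simp [leftMul]

lemma mul_mem_leftMul {C : Subalgebra R A} {e x c : A} (hc : c ∈ C) (hx : x ∈ leftMul C e) :
    c * x ∈ leftMul C e := by
  obtain ⟨d, hd, rfl⟩ := mem_leftMul.1 hx
  exact mem_leftMul.2 ⟨c * d, C.mul_mem hc hd, mul_assoc _ _ _⟩

lemma coe_mul_mem_leftMul {C : Subalgebra R A} {e c : A} (hc : c ∈ C) :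
    c * e ∈ leftMul C e :=
  mem_leftMul.2 ⟨c, hc, rfl⟩

lemma leftMul_mono {C D : Subalgebra R A} (h : C ≤ D) (e : A) : leftMul C e ≤ leftMul D e :=
  Submodule.map_mono h

/-- A submodule stable under left multiplication by `X * Y * X`. -/
def twistSpan (C : Subalgebra R A) (X f : A) : Submodule R A :=
  Submodule.span R
    ({x | ∃ c ∈ C, ∃ d ∈ C, x = c * (X * (d * X))} ∪ {x | ∃ c ∈ C, ∃ d ∈ C, x = c * (X * d)} ∪
      {x | ∃ c ∈ C, ∃ d ∈ C, x = c * (f * d)})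

variable {C : Subalgebra R A} {X f : A}

lemma mem_twistSpan_XX {c d : A} (hc : c ∈ C) (hd : d ∈ C) :
    c * (X * (d * X)) ∈ twistSpan C X f :=
  Submodule.subset_span (Or.inl (Or.inl ⟨c, hc, d, hd, rfl⟩))

lemma mem_twistSpan_X {c d : A} (hc : c ∈ C) (hd : d ∈ C) :
    c * (X * d) ∈ twistSpan C X f :=
  Submodule.subset_span (Or.inl (Or.inr ⟨c, hc, d, hd, rfl⟩))

lemma mem_twistSpan_f {c d : A} (hc : c ∈ C) (hd : d ∈ C) :
    c * (f * d) ∈ twistSpan C X f :=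
  Submodule.subset_span (Or.inr ⟨c, hc, d, hd, rfl⟩)

lemma mul_mem_twistSpan {Y Y' : A} {a b : R} (hXX : X * X = 1 + a • X + b • f)
    (hY : Y ∈ C) (hY' : Y' ∈ C) (hZf : X * Y * X * f = Y' * f)
    (hZ : ∀ c ∈ C, Commute (X * Y * X) c)
    (hXf : ∀ c ∈ C, X * c * f ∈ leftMul C f)
    (hfX : ∀ c ∈ C, ∃ d ∈ C, f * c * X = f * d) {x : A} (hx : x ∈ twistSpan C X f) :
    X * Y * X * x ∈ twistSpan C X f := by
  have hZX (d : A) (hd : d ∈ C) : X * Y * X * (X * d) =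
      1 * (X * (Y * d)) + a • (d * (X * (Y * X))) + b • (X * Y * f * d) := by
    have h1 : X * Y * X * (X * d) = X * Y * (X * X) * d := by noncomm_ring
    have h2 : X * Y * X * d = d * (X * (Y * X)) := by
      rw [(hZ d hd).eq]; noncomm_ring
    rw [h1, hXX, ← h2]
    simp only [mul_add, add_mul, mul_smul_comm, smul_mul_assoc, mul_one, one_mul, mul_assoc]
  obtain ⟨g, hg, hgf⟩ := mem_leftMul.1 (hXf Y hY)
  induction hx using Submodule.span_induction with
  | zero => simp
  | add x y _ _ hx hy => rw [mul_add]; exact add_mem hx hy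
  | smul r x _ hx => rw [mul_smul_comm]; exact Submodule.smul_mem _ _ hx
  | mem x hx =>
    rcases hx with (⟨c, hc, d, hd, rfl⟩ | ⟨c, hc, d, hd, rfl⟩) | ⟨c, hc, d, hd, rfl⟩
    · obtain ⟨d', hd', hfd⟩ := hfX d hd
      have h1 : X * Y * X * (c * (X * (d * X))) = c * (X * Y * X * (X * d)) * X := by
        rw [← mul_assoc (X * Y * X) c, (hZ c hc).eq]; noncomm_ring
      have h2 : X * (Y * X) * X = 1 * (X * Y) + a • (1 * (X * (Y * X))) + b • (g * (f * 1)) := by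
        have := hZX 1 C.one_mem
        simp only [mul_one, one_mul] at this ⊢
        rw [← mul_assoc X Y X, this, hgf, mul_assoc X Y X]
      have h3 : c * (X * Y * X * (X * d)) * X = c * (X * ((Y * d) * X))
          + a • (c * d * (X * Y)) + (a * a) • (c * d * (X * (Y * X)))
          + (a * b) • (c * d * g * (f * 1)) + b • (c * g * (f * d')) := by
        have h4 : c * (X * Y * X * (X * d)) * X = c * (X * ((Y * d) * X))
          + a • (c * d * (X * (Y * X) * X)) + b • (c * (X * Y * f) * d * X) := by
          rw [hZX d hd]
          simp only [mul_add, add_mul, mul_smul_comm, smul_mul_assoc, one_mul, mul_assoc]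
        have h5 : c * (X * Y * f) * d * X = c * g * (f * d') := by
          rw [← hgf, ← hfd]; noncomm_ring
        rw [h4, h5, h2]
        simp only [mul_add, mul_smul_comm, smul_add, smul_smul, one_mul, mul_assoc, add_assoc]
      rw [h1, h3]
      refine add_mem (add_mem (add_mem (add_mem ?_ ?_) ?_) ?_) ?_
      · exact mem_twistSpan_XX hc (C.mul_mem hY hd)
      · exact Submodule.smul_mem _ _ (mem_twistSpan_X (C.mul_mem hc hd) hY)
      · exact Submodule.smul_mem _ _ (mem_twistSpan_XX (C.mul_mem hc hd) hY)
      · exact Submodule.smul_mem _ _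
          (mem_twistSpan_f (C.mul_mem (C.mul_mem hc hd) hg) C.one_mem)
      · exact Submodule.smul_mem _ _ (mem_twistSpan_f (C.mul_mem hc hg) hd')
    · have h1 : X * Y * X * (c * (X * d)) = c * (X * Y * X * (X * d)) := by
        rw [← mul_assoc (X * Y * X) c, (hZ c hc).eq]; noncomm_ring
      have h2 : c * (X * Y * X * (X * d)) = c * (X * (Y * d)) + a • (c * d * (X * (Y * X)))
          + b • (c * g * (f * d)) := by
        rw [hZX d hd, ← hgf]
        simp only [mul_add, mul_smul_comm, one_mul, mul_assoc]
      rw [h1, h2]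
      refine add_mem (add_mem ?_ ?_) ?_
      · exact mem_twistSpan_X hc (C.mul_mem hY hd)
      · exact Submodule.smul_mem _ _ (mem_twistSpan_XX (C.mul_mem hc hd) hY)
      · exact Submodule.smul_mem _ _ (mem_twistSpan_f (C.mul_mem hc hg) hd)
    · have h1 : X * Y * X * (c * (f * d)) = c * Y' * (f * d) := by
        rw [← mul_assoc (X * Y * X) c, (hZ c hc).eq, mul_assoc c, ← mul_assoc (X * Y * X), hZf]
        noncomm_ring
      rw [h1]
      exact mem_twistSpan_f (C.mul_mem hc hY') hd

lemma compress_twistSpan {e V : A} {a b v : R} (hVV : V * V = 1 + a • V + b • e)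
    (hXe : X * e = V * f * e) (heX : e * X = e * f * V) (hVe : V * e = v • e)
    (hefe : e * f * e = e) (he : ∀ c ∈ C, Commute e c) (hV : ∀ c ∈ C, Commute V c)
    (hf : ∀ c ∈ C, f * c * f ∈ leftMul C f)
    (hfX : ∀ c ∈ C, ∃ d ∈ C, f * c * X = f * d) {x : A} (hx : x ∈ twistSpan C X f) :
    e * x * e ∈ leftMul C e := by
  have hecfe (c : A) (hc : c ∈ C) : e * f * c * e = c * e := by
    rw [mul_assoc, ← (he c hc).eq, ← mul_assoc, hefe, (he c hc).eq]
  have hefce (c : A) (hc : c ∈ C) : e * c * f * e = c * e := by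
    rw [(he c hc).eq, mul_assoc, mul_assoc, ← mul_assoc e, hefe]
  induction hx using Submodule.span_induction with
  | zero => simp
  | add x y _ _ hx hy => rw [mul_add, add_mul]; exact add_mem hx hy
  | smul r x _ hx =>
    rw [mul_smul_comm, smul_mul_assoc]; exact Submodule.smul_mem _ _ hx
  | mem x hx =>
    rcases hx with (⟨c, hc, d, hd, rfl⟩ | ⟨c, hc, d, hd, rfl⟩) | ⟨c, hc, d, hd, rfl⟩
    · obtain ⟨g, hg, hgf⟩ := mem_leftMul.1 (hf d hd)
      obtain ⟨d', hd', hfd⟩ := hfX d hd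
      have h1 : e * (c * (X * (d * X))) * e = c * ((e * X) * d * (X * e)) := by
        rw [← mul_assoc e c, (he c hc).eq]; noncomm_ring
      have h2 : (e * X) * d * (X * e) = e * (f * d * f) * e + a • (e * (f * d * X) * e)
          + b • (e * f * (d * e) * f * e) := by
        have : (e * X) * d * (X * e) = e * f * d * (V * V) * f * e := by
          rw [hXe, heX, mul_assoc (e * f) V d, (hV d hd).eq]; noncomm_ring
        rw [this, hVV]
        have h3 : e * (f * d * X) * e = e * f * d * V * f * e := by
          rw [mul_assoc, mul_assoc _ X e, hXe]; noncomm_ring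
        rw [h3]
        simp only [mul_add, add_mul, mul_smul_comm, smul_mul_assoc, mul_one, mul_assoc]
      have h4 : e * f * (d * e) * f * e = d * e := by
        rw [← mul_assoc (e * f), hecfe d hd, mul_assoc, mul_assoc, ← mul_assoc e, hefe]
      rw [h1, h2, h4, ← hgf, hfd, ← mul_assoc e g, ← mul_assoc e f, hefce g hg, hecfe d' hd']
      refine mul_mem_leftMul hc (add_mem (add_mem ?_ ?_) ?_)
      · exact coe_mul_mem_leftMul hg
      · exact Submodule.smul_mem _ _ (coe_mul_mem_leftMul hd')
      · exact Submodule.smul_mem _ _ (coe_mul_mem_leftMul hd)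
    · have h1 : e * (c * (X * d)) * e = v • (c * d * e) := by
        calc e * (c * (X * d)) * e = (e * c) * X * (d * e) := by noncomm_ring
          _ = c * (e * X * e) * d := by rw [(he c hc).eq, ← (he d hd).eq]; noncomm_ring
          _ = v • (c * (e * f * e) * d) := by
            rw [heX, mul_assoc (e * f), hVe, mul_smul_comm, mul_smul_comm, smul_mul_assoc]
          _ = v • (c * d * e) := by rw [hefe, mul_assoc, (he d hd).eq, ← mul_assoc]
      rw [h1]
      exact Submodule.smul_mem _ _ (coe_mul_mem_leftMul (C.mul_mem hc hd))
    · have h1 : e * (c * (f * d)) * e = c * (e * f * d * e) := by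
        rw [← mul_assoc e c, (he c hc).eq]; noncomm_ring
      rw [h1, hecfe d hd, ← mul_assoc]
      exact coe_mul_mem_leftMul (C.mul_mem hc hd)

/-- If `Z = X * Y * X`, then `e * Z ^ m * e` lies in `C e` for all `m`. -/
lemma compress_pow_mem {e V Y Y' : A} {a b a' b' v z : R} (hXX : X * X = 1 + a • X + b • f)
    (hY : Y ∈ C) (hY' : Y' ∈ C) (hZf : X * Y * X * f = Y' * f)
    (hZ : ∀ c ∈ C, Commute (X * Y * X) c)
    (hXf : ∀ c ∈ C, X * c * f ∈ leftMul C f)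
    (hfX : ∀ c ∈ C, ∃ d ∈ C, f * c * X = f * d)
    (hVV : V * V = 1 + a' • V + b' • e)
    (hXe : X * e = V * f * e) (heX : e * X = e * f * V) (hVe : V * e = v • e)
    (hefe : e * f * e = e) (he : ∀ c ∈ C, Commute e c) (hV : ∀ c ∈ C, Commute V c)
    (hf : ∀ c ∈ C, f * c * f ∈ leftMul C f) (hee : e * e = z • e) (m : ℕ) :
    e * (X * Y * X) ^ m * e ∈ leftMul C e := by
  rcases m with _ | m
  · rw [pow_zero, mul_one, hee]
    exact Submodule.smul_mem _ _ (mem_leftMul.2 ⟨1, C.one_mem, one_mul e⟩)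
  · refine compress_twistSpan hVV hXe heX hVe hefe he hV hf hfX (X := X) ?_
    induction m with
    | zero =>
      have := mem_twistSpan_XX (X := X) (f := f) C.one_mem hY
      simpa [mul_assoc] using this
    | succ m ih =>
      rw [pow_succ']
      exact mul_mem_twistSpan hXX hY hY' hZf hZ hXf hfX ih

end Abstract

variable {R : Type} [CommRing R] (P : Params R)

section Relations

variable {P}

lemma pr_eq {a b : F R} (h : Rel P a b) : pr P a = pr P b :=
  RingQuot.mkAlgHom_rel R h

lemma X_mul_Xi (i : ℕ) : Xg P i * Xgi P i = 1 := by
  by_cases h : 1 ≤ i ∧ i ≤ P.n - 1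
  · simpa [Xg, Xgi] using pr_eq (Rel.X_inv_right (P := P) h.1 h.2)
  · have h' : i = 0 ∨ P.n - 1 < i := by omega
    simpa [Xg, Xgi] using congrArg₂ (· * ·) (pr_eq (Rel.X_invalid (P := P) h'))
      (pr_eq (Rel.Xi_invalid (P := P) h'))

lemma Xi_mul_X (i : ℕ) : Xgi P i * Xg P i = 1 := by
  by_cases h : 1 ≤ i ∧ i ≤ P.n - 1
  · simpa [Xg, Xgi] using pr_eq (Rel.X_inv_left (P := P) h.1 h.2)
  · have h' : i = 0 ∨ P.n - 1 < i := by omega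
    simpa [Xg, Xgi] using congrArg₂ (· * ·) (pr_eq (Rel.Xi_invalid (P := P) h'))
      (pr_eq (Rel.X_invalid (P := P) h'))

lemma Y_mul_Yi : Yg P * Ygi P = 1 := by
  simpa [Yg, Ygi] using pr_eq (Rel.Y_inv_right (P := P))

lemma Yi_mul_Y : Ygi P * Yg P = 1 := by
  simpa [Yg, Ygi] using pr_eq (Rel.Y_inv_left (P := P))

lemma X_sub_Xi {i : ℕ} (h1 : 1 ≤ i) (h2 : i ≤ P.n - 1) :
    Xg P i - Xgi P i = P.delta • (1 - Eg P i) := by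
  simpa [Xg, Xgi, Eg] using pr_eq (Rel.skein (P := P) h1 h2)

lemma commute_X_X {i j : ℕ} (h1 : 1 ≤ i) (h2 : i ≤ P.n - 1) (h3 : 1 ≤ j) (h4 : j ≤ P.n - 1)
    (h : i + 2 ≤ j ∨ j + 2 ≤ i) : Commute (Xg P i) (Xg P j) := by
  simpa [commute_iff_eq, Xg] using pr_eq (Rel.XX_far (P := P) h1 h2 h3 h4 h)

lemma commute_X_E {i j : ℕ} (h1 : 1 ≤ i) (h2 : i ≤ P.n - 1) (h3 : 1 ≤ j) (h4 : j ≤ P.n - 1)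
    (h : i + 2 ≤ j ∨ j + 2 ≤ i) : Commute (Xg P i) (Eg P j) := by
  simpa [commute_iff_eq, Xg, Eg] using pr_eq (Rel.XE_far (P := P) h1 h2 h3 h4 h)

lemma X_braid {i : ℕ} (h1 : 1 ≤ i) (h2 : i + 1 ≤ P.n - 1) :
    Xg P i * Xg P (i + 1) * Xg P i = Xg P (i + 1) * Xg P i * Xg P (i + 1) := by
  simpa [Xg] using pr_eq (Rel.braid (P := P) h1 h2)

lemma X_mul_E {i : ℕ} (h1 : 1 ≤ i) (h2 : i ≤ P.n - 1) :
    Xg P i * Eg P i = (P.lam : R) • Eg P i := by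
  simpa [Xg, Eg] using pr_eq (Rel.untwist_right (P := P) h1 h2)

lemma E_mul_X {i : ℕ} (h1 : 1 ≤ i) (h2 : i ≤ P.n - 1) :
    Eg P i * Xg P i = (P.lam : R) • Eg P i := by
  simpa [Xg, Eg] using pr_eq (Rel.untwist_left (P := P) h1 h2)

lemma X_mul_X_mul_E {i j : ℕ} (h1 : 1 ≤ i) (h2 : i ≤ P.n - 1) (h3 : 1 ≤ j) (h4 : j ≤ P.n - 1)
    (h : j = i + 1 ∨ i = j + 1) : Xg P i * Xg P j * Eg P i = Eg P j * Eg P i := by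
  simpa [Xg, Eg] using pr_eq (Rel.XXE (P := P) h1 h2 h3 h4 h)

lemma E_mul_X_mul_X {i j : ℕ} (h1 : 1 ≤ i) (h2 : i ≤ P.n - 1) (h3 : 1 ≤ j) (h4 : j ≤ P.n - 1)
    (h : j = i + 1 ∨ i = j + 1) : Eg P j * Xg P i * Xg P j = Eg P j * Eg P i := by
  simpa [Xg, Eg] using (pr_eq (Rel.EXX (P := P) h1 h2 h3 h4 h)).symm

lemma E_mul_E_mul_E_up {i : ℕ} (h1 : 1 ≤ i) (h2 : i + 1 ≤ P.n - 1) :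
    Eg P i * Eg P (i + 1) * Eg P i = Eg P i := by
  simpa [Eg] using pr_eq (Rel.EEE_up (P := P) h1 h2)

lemma E_mul_E_mul_E_down {i : ℕ} (h1 : 1 ≤ i) (h2 : i + 1 ≤ P.n - 1) :
    Eg P (i + 1) * Eg P i * Eg P (i + 1) = Eg P (i + 1) := by
  simpa [Eg] using pr_eq (Rel.EEE_down (P := P) h1 h2)

lemma E_mul_E {i : ℕ} (h1 : 1 ≤ i) (h2 : i ≤ P.n - 1) :
    Eg P i * Eg P i = P.A 0 • Eg P i := by
  simpa [Eg] using pr_eq (Rel.E_sq (P := P) h1 h2)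

lemma Y_pow_k : Yg P ^ P.k = ∑ i ∈ Finset.range P.k, P.qc i • Yg P ^ i := by
  simpa [Yg, map_sum] using pr_eq (Rel.cyclo (P := P))

lemma X_Y_braid (h : 2 ≤ P.n) :
    Xg P 1 * Yg P * Xg P 1 * Yg P = Yg P * Xg P 1 * Yg P * Xg P 1 := by
  simpa [Xg, Yg] using pr_eq (Rel.braidB (P := P) h)

lemma commute_Y_X {i : ℕ} (h1 : 2 ≤ i) (h2 : i ≤ P.n - 1) : Commute (Yg P) (Xg P i) := by
  simpa [commute_iff_eq, Xg, Yg] using pr_eq (Rel.YX_comm (P := P) h1 h2)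

lemma commute_Y_E {i : ℕ} (h1 : 2 ≤ i) (h2 : i ≤ P.n - 1) : Commute (Yg P) (Eg P i) := by
  simpa [commute_iff_eq, Eg, Yg] using pr_eq (Rel.YE_comm (P := P) h1 h2)

lemma Y_X_Y_E (h : 2 ≤ P.n) : Yg P * Xg P 1 * Yg P * Eg P 1 = P.laminv • Eg P 1 := by
  simpa [Xg, Yg, Eg] using pr_eq (Rel.YXYE (P := P) h)

lemma E_Y_pow_E (h : 2 ≤ P.n) {m : ℕ} (hm : m ≤ P.k - 1) :
    Eg P 1 * Yg P ^ m * Eg P 1 = P.A m • Eg P 1 := by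
  simpa [Yg, Eg] using pr_eq (Rel.EYE (P := P) h hm)

end Relations

section Star

open MulOpposite

/-- The anti-automorphism of the cyclotomic BMW algebra fixing the generators. -/
def starHom : Alg P →ₐ[R] (Alg P)ᵐᵒᵖ :=
  RingQuot.liftAlgHom R ⟨FreeAlgebra.lift R fun g => op (pr P (FreeAlgebra.ι R g)), by
    have hY : FreeAlgebra.lift R (fun g => op (pr P (FreeAlgebra.ι R g))) fY = op (Yg P) :=
      FreeAlgebra.lift_ι_apply _ _
    have hYi : FreeAlgebra.lift R (fun g => op (pr P (FreeAlgebra.ι R g))) fYi = op (Ygi P) :=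
      FreeAlgebra.lift_ι_apply _ _
    have hX (i : ℕ) :
        FreeAlgebra.lift R (fun g => op (pr P (FreeAlgebra.ι R g))) (fX i) = op (Xg P i) :=
      FreeAlgebra.lift_ι_apply _ _
    have hXi (i : ℕ) :
        FreeAlgebra.lift R (fun g => op (pr P (FreeAlgebra.ι R g))) (fXi i) = op (Xgi P i) :=
      FreeAlgebra.lift_ι_apply _ _
    have hE (i : ℕ) :
        FreeAlgebra.lift R (fun g => op (pr P (FreeAlgebra.ι R g))) (fE i) = op (Eg P i) :=
      FreeAlgebra.lift_ι_apply _ _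
    intro x y h
    induction h <;>
      simp only [map_mul, map_sub, map_one, map_zero, map_smul, map_pow, map_sum, hY, hYi, hX, hXi,
        hE] <;> apply unop_injective <;>
      simp only [unop_mul, unop_op, unop_one, unop_zero, unop_sub, unop_smul, unop_pow,
        Finset.unop_sum]
    case X_inv_right => exact Xi_mul_X _
    case X_inv_left => exact X_mul_Xi _
    case Y_inv_right => exact Yi_mul_Y
    case Y_inv_left => exact Y_mul_Yi
    case X_invalid h => simpa [Xg] using pr_eq (Rel.X_invalid h)
    case Xi_invalid h => simpa [Xgi] using pr_eq (Rel.Xi_invalid h)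
    case E_invalid h => simpa [Eg] using pr_eq (Rel.E_invalid h)
    case skein h1 h2 => exact X_sub_Xi h1 h2
    case XX_far h1 h2 h3 h4 h => exact (commute_X_X h1 h2 h3 h4 h).symm
    case braid h1 h2 => rw [← mul_assoc, ← mul_assoc]; exact X_braid h1 h2
    case XE_far h1 h2 h3 h4 h => exact (commute_X_E h1 h2 h3 h4 h).symm
    case EE_far h1 h2 h3 h4 h => simpa [Eg] using (pr_eq (Rel.EE_far h1 h2 h3 h4 h)).symm
    case untwist_right h1 h2 => exact E_mul_X h1 h2
    case untwist_left h1 h2 => exact X_mul_E h1 h2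
    case XXE h1 h2 h3 h4 h =>
      rw [← mul_assoc]; exact E_mul_X_mul_X h3 h4 h1 h2 h.symm
    case EXX h1 h2 h3 h4 h =>
      rw [← mul_assoc]; exact (X_mul_X_mul_E h3 h4 h1 h2 h.symm).symm
    case EEE_up h1 h2 => rw [← mul_assoc]; exact E_mul_E_mul_E_up h1 h2
    case EEE_down h1 h2 => rw [← mul_assoc]; exact E_mul_E_mul_E_down h1 h2
    case E_sq h1 h2 => exact E_mul_E h1 h2
    case cyclo => exact Y_pow_k
    case braidB h => simpa [mul_assoc] using (X_Y_braid h).symm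
    case YX_comm h1 h2 => exact (commute_Y_X h1 h2).symm
    case YE_comm h1 h2 => exact (commute_Y_E h1 h2).symm
    case YXYE h =>
      have := pr_eq (Rel.EYXY h)
      simpa [Xg, Yg, Eg, mul_assoc] using this
    case EYXY h =>
      have := Y_X_Y_E h
      simpa [mul_assoc] using this
    case EYE h hm => rw [← mul_assoc]; exact E_Y_pow_E h hm⟩

lemma starHom_pr_ι (g : BMWGen) :
    starHom P (pr P (FreeAlgebra.ι R g)) = op (pr P (FreeAlgebra.ι R g)) :=
  (RingQuot.liftAlgHom_mkAlgHom_apply ..).trans (FreeAlgebra.lift_ι_apply _ _)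

end Star

section JucysMurphy

lemma upX_mul_downXi (m : ℕ) : upX P m * downXi P m = 1 := by
  induction m with
  | zero => simp [upX, downXi]
  | succ m ih =>
    rw [upX, downXi, mul_assoc, ← mul_assoc (Xg P (m + 1)), X_mul_Xi, one_mul, ih]

lemma upXi_mul_downX (m : ℕ) : upXi P m * downX P m = 1 := by
  induction m with
  | zero => simp [upXi, downX]
  | succ m ih =>
    rw [upXi, downX, mul_assoc, ← mul_assoc (Xgi P (m + 1)), Xi_mul_X, one_mul, ih]

lemma downX_mul_upXi (m : ℕ) : downX P m * upXi P m = 1 := by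
  induction m with
  | zero => simp [upXi, downX]
  | succ m ih =>
    rw [upXi, downX, mul_assoc, ← mul_assoc (downX P m), ih, one_mul, X_mul_Xi]

lemma downXi_mul_upX (m : ℕ) : downXi P m * upX P m = 1 := by
  induction m with
  | zero => simp [upX, downXi]
  | succ m ih =>
    rw [upX, downXi, mul_assoc, ← mul_assoc (downXi P m), ih, one_mul, Xi_mul_X]

/-- `Xᵢ` as a unit. -/
def Xu (i : ℕ) : (Alg P)ˣ := ⟨Xg P i, Xgi P i, X_mul_Xi i, Xi_mul_X i⟩

/-- `Yᵢ'` as a unit. -/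
def Yu (i : ℕ) : (Alg P)ˣ where
  val := Yp P i
  inv := YpInv P i
  val_inv := by
    rw [Yp, YpInv]
    calc downX P (i - 1) * Yg P * upX P (i - 1) * (downXi P (i - 1) * Ygi P * upXi P (i - 1))
        = downX P (i - 1) * Yg P * (upX P (i - 1) * downXi P (i - 1)) * Ygi P * upXi P (i - 1) := by
          noncomm_ring
      _ = 1 := by
          rw [upX_mul_downXi, mul_one, mul_assoc (downX P _), Y_mul_Yi, mul_one, downX_mul_upXi]
  inv_val := by
    rw [Yp, YpInv]
    calc downXi P (i - 1) * Ygi P * upXi P (i - 1) * (downX P (i - 1) * Yg P * upX P (i - 1))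
        = downXi P (i - 1) * Ygi P * (upXi P (i - 1) * downX P (i - 1)) * Yg P * upX P (i - 1) := by
          noncomm_ring
      _ = 1 := by
          rw [upXi_mul_downX, mul_one, mul_assoc (downXi P _), Yi_mul_Y, mul_one, downXi_mul_upX]

lemma coe_Yu (i : ℕ) : (Yu P i : Alg P) = Yp P i := rfl

lemma Ypow_eq (i : ℕ) (p : ℤ) : Ypow P i p = ((Yu P i ^ p : (Alg P)ˣ) : Alg P) := by
  unfold Ypow
  split_ifs with h
  · lift p to ℕ using h
    simp [coe_Yu]
  · obtain ⟨m, rfl⟩ : ∃ m : ℕ, p = -(m : ℤ) := ⟨(-p).toNat, by omega⟩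
    simp only [neg_neg, Int.toNat_natCast, zpow_neg, zpow_natCast, ← inv_pow,
      Units.val_pow_eq_pow_val]
    rfl

variable {P}

lemma Yp_succ {i : ℕ} (hi : 1 ≤ i) : Yp P (i + 1) = Xg P i * Yp P i * Xg P i := by
  obtain ⟨j, rfl⟩ : ∃ j, i = j + 1 := ⟨i - 1, by omega⟩
  simp [Yp, downX, upX, mul_assoc]

lemma Yp_one : Yp P 1 = Yg P := by simp [Yp, downX, upX]

lemma commute_Yp_X_of_lt {i j : ℕ} (hi : 1 ≤ i) (hij : i < j) (hj : j ≤ P.n - 1) :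
    Commute (Yp P i) (Xg P j) := by
  induction i, hi using Nat.le_induction with
  | base => rw [Yp_one]; exact commute_Y_X hij hj
  | succ i hi ih =>
    have hX : Commute (Xg P i) (Xg P j) :=
      commute_X_X hi (by omega) (by omega) hj (by omega)
    rw [Yp_succ hi]
    exact (hX.mul_left (ih (by omega))).mul_left hX

lemma commute_Yp_E_of_lt {i j : ℕ} (hi : 1 ≤ i) (hij : i < j) (hj : j ≤ P.n - 1) :
    Commute (Yp P i) (Eg P j) := by
  induction i, hi using Nat.le_induction with
  | base => rw [Yp_one]; exact commute_Y_E hij hj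
  | succ i hi ih =>
    have hX : Commute (Xg P i) (Eg P j) :=
      commute_X_E hi (by omega) (by omega) hj (by omega)
    rw [Yp_succ hi]
    exact (hX.mul_left (ih (by omega))).mul_left hX

lemma commute_Yp_X_of_gt {i j : ℕ} (hj : 1 ≤ j) (hij : j + 2 ≤ i) (hi : i ≤ P.n) :
    Commute (Yp P i) (Xg P j) := by
  induction i, hij using Nat.le_induction with
  | base =>
    have hW : Commute (Yp P j) (Xg P (j + 1)) := commute_Yp_X_of_lt hj (by omega) (by omega)
    have hb := X_braid (P := P) hj (by omega)
    rw [Yp_succ (by omega), Yp_succ hj, commute_iff_eq]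
    generalize Xg P j = X at *
    generalize Xg P (j + 1) = W at *
    generalize Yp P j = Y at *
    calc W * (X * Y * X) * W * X = W * X * Y * (X * W * X) := by noncomm_ring
      _ = W * X * (Y * W) * X * W := by rw [hb]; noncomm_ring
      _ = (W * X * W) * Y * X * W := by rw [hW.eq]; noncomm_ring
      _ = X * (W * (X * Y * X) * W) := by rw [← hb]; noncomm_ring
  | succ i hij ih =>
    have hX : Commute (Xg P i) (Xg P j) :=
      commute_X_X (by omega) (by omega) hj (by omega) (by omega)
    rw [Yp_succ (by omega)]
    exact (hX.mul_left (ih (by omega))).mul_left hX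

lemma commute_Yp_Yg {i : ℕ} (hi : 1 ≤ i) (hin : i ≤ P.n) : Commute (Yp P i) (Yg P) := by
  rcases hi.eq_or_lt with rfl | hi2
  · rw [Yp_one]
  · clear hi
    induction i, hi2 using Nat.le_induction with
    | base =>
      rw [Yp_succ le_rfl, Yp_one, commute_iff_eq, X_Y_braid hin]
      noncomm_ring
    | succ i hi ih =>
      have hi' : 2 ≤ i := hi
      have hX := (commute_Y_X (P := P) hi' (by omega)).symm
      rw [Yp_succ (by omega)]
      exact (hX.mul_left (ih (by omega))).mul_left hX

lemma commute_Yp_Yp_of_lt {i j : ℕ} (hj : 1 ≤ j) (hij : j < i) (hi : i ≤ P.n) :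
    Commute (Yp P i) (Yp P j) := by
  induction j, hj using Nat.le_induction with
  | base => rw [Yp_one]; exact commute_Yp_Yg (by omega) hi
  | succ j hj ih =>
    have hX : Commute (Yp P i) (Xg P j) := commute_Yp_X_of_gt hj (by omega) hi
    rw [Yp_succ hj]
    exact (hX.mul_right (ih (by omega))).mul_right hX

lemma commute_Yp_Yp {i j : ℕ} (hi : 1 ≤ i) (hin : i ≤ P.n) (hj : 1 ≤ j) (hjn : j ≤ P.n) :
    Commute (Yp P i) (Yp P j) := by
  rcases lt_trichotomy i j with h | rfl | h
  · exact (commute_Yp_Yp_of_lt hi h hjn).symm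
  · exact Commute.refl _
  · exact commute_Yp_Yp_of_lt hj h hin

lemma lam_smul_laminv_smul (x : Alg P) : (P.lam : R) • P.laminv • x = x := by
  rw [smul_smul, Params.laminv, Units.mul_inv, one_smul]

lemma laminv_smul_lam_smul (x : Alg P) : P.laminv • (P.lam : R) • x = x := by
  rw [smul_smul, Params.laminv, Units.inv_mul, one_smul]

lemma Yp_mul_Yp_succ_mul_E {i : ℕ} (hi : 1 ≤ i) (hin : i ≤ P.n - 1) :
    Yp P i * Yp P (i + 1) * Eg P i = Eg P i := by
  induction i, hi using Nat.le_induction with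
  | base =>
    rw [Yp_succ le_rfl, Yp_one]
    calc Yg P * (Xg P 1 * Yg P * Xg P 1) * Eg P 1
        = Yg P * Xg P 1 * Yg P * (Xg P 1 * Eg P 1) := by noncomm_ring
      _ = Eg P 1 := by
        rw [X_mul_E le_rfl hin, mul_smul_comm, Y_X_Y_E (by omega), lam_smul_laminv_smul]
  | succ i hi ih =>
    have ih := ih (by omega)
    have hXf := X_mul_E (P := P) hi (by omega)
    have hb := X_braid (P := P) hi hin
    have hefe := E_mul_E_mul_E_down (P := P) hi hin
    have hfef := E_mul_E_mul_E_up (P := P) hi hin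
    have hXWf : Xg P i * Xg P (i + 1) * Eg P i = Eg P (i + 1) * Eg P i :=
      X_mul_X_mul_E hi (by omega) (by omega) hin (by omega)
    have hWXe : Xg P (i + 1) * Xg P i * Eg P (i + 1) = Eg P i * Eg P (i + 1) :=
      X_mul_X_mul_E (by omega) hin hi (by omega) (by omega)
    have hYW : Commute (Yp P i) (Xg P (i + 1)) := commute_Yp_X_of_lt hi (by omega) hin
    rw [Yp_succ hi] at ih
    rw [Yp_succ (i := i + 1) (by omega), Yp_succ hi]
    generalize Xg P i = X at *
    generalize Xg P (i + 1) = W at *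
    generalize Yp P i = Y at *
    generalize Eg P i = f at *
    generalize Eg P (i + 1) = e at *
    have key : X * Y * X * (W * (X * Y * X) * W) * (X * W * f) = X * W * f := by
      calc X * Y * X * (W * (X * Y * X) * W) * (X * W * f)
          = X * Y * (X * W * X) * Y * X * (W * X * W) * f := by noncomm_ring
        _ = X * Y * (W * X * W) * Y * X * (X * W * X) * f := by rw [hb]
        _ = X * (Y * W) * X * (W * Y) * X * X * W * (X * f) := by noncomm_ring
        _ = X * (W * Y) * X * (Y * W) * X * X * W * ((P.lam : R) • f) := by rw [hXf, hYW.eq]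
        _ = (P.lam : R) • (X * W * Y * X * Y * W * X * (X * W * f)) := by
          simp only [mul_smul_comm, mul_assoc]
        _ = (P.lam : R) • (X * W * Y * X * Y * (W * X * e) * f) := by
          rw [hXWf]; simp only [mul_assoc]
        _ = X * W * Y * X * Y * ((P.lam : R) • f) := by
          rw [hWXe, mul_assoc _ (f * e), hfef, mul_smul_comm]
        _ = X * W * (Y * (X * Y * X) * f) := by rw [← hXf]; noncomm_ring
        _ = X * W * f := by rw [ih]
    calc X * Y * X * (W * (X * Y * X) * W) * e
        = X * Y * X * (W * (X * Y * X) * W) * (X * W * f) * e := by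
          rw [hXWf, mul_assoc _ (e * f), hefe]
      _ = e := by rw [key, hXWf, hefe]

lemma Yp_succ_mul_E {i : ℕ} (hi : 1 ≤ i) (hin : i ≤ P.n - 1) :
    Yp P (i + 1) * Eg P i = YpInv P i * Eg P i := by
  have h := Yp_mul_Yp_succ_mul_E hi hin
  have h' : YpInv P i * (Yp P i * Yp P (i + 1) * Eg P i) = Yp P (i + 1) * Eg P i := by
    rw [mul_assoc, ← mul_assoc, show YpInv P i * Yp P i = 1 from (Yu P i).inv_mul, one_mul]
  rw [← h', h]

lemma YpInv_succ_mul_E {i : ℕ} (hi : 1 ≤ i) (hin : i ≤ P.n - 1) :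
    YpInv P (i + 1) * Eg P i = Yp P i * Eg P i := by
  have h := Yp_mul_Yp_succ_mul_E hi hin
  have hc := commute_Yp_Yp (P := P) (i := i) (j := i + 1) hi (by omega) (by omega) (by omega)
  have h' : YpInv P (i + 1) * (Yp P i * Yp P (i + 1) * Eg P i) = Yp P i * Eg P i := by
    rw [hc.eq, mul_assoc, ← mul_assoc,
      show YpInv P (i + 1) * Yp P (i + 1) = 1 from (Yu P (i + 1)).inv_mul, one_mul]
  rw [← h', h]

end JucysMurphy

section Commutative

variable {P}

lemma coe_inv_Yu (i : ℕ) : (((Yu P i)⁻¹ : (Alg P)ˣ) : Alg P) = YpInv P i := rfl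

lemma Ypow_zero (i : ℕ) : Ypow P i 0 = 1 := by simp [Ypow]

lemma Ypow_one (i : ℕ) : Ypow P i 1 = Yp P i := by simp [Ypow]

lemma Ypow_neg_one (i : ℕ) : Ypow P i (-1) = YpInv P i := by simp [Ypow]

lemma Ypow_natCast (i m : ℕ) : Ypow P i m = Yp P i ^ m := by simp [Ypow]

lemma Ypow_neg_natCast (i m : ℕ) : Ypow P i (-(m : ℤ)) = YpInv P i ^ m := by
  rw [Ypow_eq, zpow_neg, zpow_natCast, ← inv_pow, Units.val_pow_eq_pow_val, coe_inv_Yu]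

lemma Ypow_add (i : ℕ) (p r : ℤ) : Ypow P i (p + r) = Ypow P i p * Ypow P i r := by
  simp [Ypow_eq, zpow_add]

lemma commute_Ypow {x : Alg P} {i : ℕ} (h : Commute x (Yp P i)) (p : ℤ) :
    Commute x (Ypow P i p) := by
  rw [Ypow_eq]
  exact Commute.units_zpow_right (u := Yu P i) h p

lemma commute_YpowProd {x : Alg P} {m : ℕ} (h : ∀ j, 1 ≤ j → j ≤ m → Commute x (Yp P j))
    (s : ℕ → ℤ) : Commute x (YpowProd P s m) := by
  induction m with
  | zero => exact Commute.one_right x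
  | succ m ih =>
    exact (ih fun j hj hjm => h j hj (by omega)).mul_right
      (commute_Ypow (h (m + 1) (by omega) le_rfl) _)

lemma YpowProd_congr {s t : ℕ → ℤ} {m : ℕ} (h : ∀ j, 1 ≤ j → j ≤ m → s j = t j) :
    YpowProd P s m = YpowProd P t m := by
  induction m with
  | zero => rfl
  | succ m ih =>
    rw [YpowProd, YpowProd, ih fun j hj hjm => h j hj (by omega), h (m + 1) (by omega) le_rfl]

lemma YpowProd_zero (m : ℕ) : YpowProd P 0 m = 1 := by
  induction m with
  | zero => rfl
  | succ m ih => rw [YpowProd, ih, Pi.zero_apply, Ypow_zero, mul_one]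

lemma YpowProd_update (s : ℕ → ℤ) (m : ℕ) (p : ℤ) :
    YpowProd P (Function.update s (m + 1) p) (m + 1) = YpowProd P s m * Ypow P (m + 1) p := by
  rw [YpowProd, Function.update_self, YpowProd_congr (t := s)]
  intro j _ hj
  exact Function.update_of_ne (by omega) _ _

lemma YpowProd_mul {m : ℕ} (hm : m ≤ P.n) (s t : ℕ → ℤ) :
    YpowProd P s m * YpowProd P t m = YpowProd P (s + t) m := by
  induction m with
  | zero => simp [YpowProd]
  | succ m ih =>
    have hc : Commute (Ypow P (m + 1) (s (m + 1))) (YpowProd P t m) :=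
      commute_YpowProd (fun j hj hjm => (commute_Ypow
        (commute_Yp_Yp hj (by omega) (by omega) hm) _).symm) t
    simp only [YpowProd]
    rw [Pi.add_apply, Ypow_add, ← ih (by omega)]
    calc _ = YpowProd P s m * (Ypow P (m + 1) (s (m + 1)) * YpowProd P t m) *
          Ypow P (m + 1) (t (m + 1)) := by simp only [mul_assoc]
      _ = _ := by rw [hc.eq]; simp only [mul_assoc]

variable (P) in
/-- The commutative subalgebra spanned by the monomials in `Y^{±1}, …, (Y_m')^{±1}`. -/
def jmSub (m : ℕ) : Subalgebra R (Alg P) :=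
  Algebra.adjoin R (Set.range fun s : ℕ → ℤ => YpowProd P s m)

lemma YpowProd_mem (s : ℕ → ℤ) (m : ℕ) : YpowProd P s m ∈ jmSub P m :=
  Algebra.subset_adjoin ⟨s, rfl⟩

lemma toSubmodule_jmSub {m : ℕ} (hm : m ≤ P.n) :
    Subalgebra.toSubmodule (jmSub P m) =
      Submodule.span R (Set.range fun s : ℕ → ℤ => YpowProd P s m) := by
  let M : Submonoid (Alg P) :=
    { carrier := Set.range fun s : ℕ → ℤ => YpowProd P s m
      one_mem' := ⟨0, YpowProd_zero m⟩
      mul_mem' := by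
        rintro _ _ ⟨s, rfl⟩ ⟨t, rfl⟩
        exact ⟨s + t, (YpowProd_mul hm s t).symm⟩ }
  rw [jmSub, Algebra.adjoin_eq_span]
  exact congrArg (fun N : Submonoid (Alg P) => Submodule.span R (N : Set (Alg P)))
    (Submonoid.closure_eq M)

lemma jmSub_induction {m : ℕ} (hm : m ≤ P.n) {p : Alg P → Prop}
    (mem : ∀ s, p (YpowProd P s m)) (zero : p 0) (add : ∀ x y, p x → p y → p (x + y))
    (smul : ∀ (r : R) x, p x → p (r • x)) {c : Alg P} (hc : c ∈ jmSub P m) : p c := by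
  rw [← Subalgebra.mem_toSubmodule, toSubmodule_jmSub hm] at hc
  induction hc using Submodule.span_induction with
  | zero => exact zero
  | add x y _ _ hx hy => exact add x y hx hy
  | smul r x _ hx => exact smul r x hx
  | mem x hx => obtain ⟨s, rfl⟩ := hx; exact mem s

lemma commute_jmSub {x : Alg P} {m : ℕ} (hm : m ≤ P.n)
    (h : ∀ j, 1 ≤ j → j ≤ m → Commute x (Yp P j)) {c : Alg P} (hc : c ∈ jmSub P m) :
    Commute x c :=
  jmSub_induction hm (p := Commute x) (commute_YpowProd h) (Commute.zero_right x)
    (fun _ _ => Commute.add_right) (fun r _ hx => hx.smul_right r) hc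

lemma jmSub_le_succ (m : ℕ) : jmSub P m ≤ jmSub P (m + 1) := by
  refine Algebra.adjoin_le ?_
  rintro _ ⟨s, rfl⟩
  have := YpowProd_mem (P := P) (Function.update s (m + 1) 0) (m + 1)
  rwa [YpowProd_update, Ypow_zero, mul_one] at this

lemma Ypow_mem (m : ℕ) (p : ℤ) : Ypow P (m + 1) p ∈ jmSub P (m + 1) := by
  have := YpowProd_mem (P := P) (Function.update 0 (m + 1) p) (m + 1)
  rwa [YpowProd_update, YpowProd_zero, one_mul] at this

lemma leftMul_jmSub {m : ℕ} (hm : m ≤ P.n) (e : Alg P) :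
    leftMul (jmSub P m) e = Submodule.span R {x | ∃ s : ℕ → ℤ, x = YpowProd P s m * e} := by
  rw [leftMul, toSubmodule_jmSub hm, Submodule.map_span]
  congr 1
  ext x
  simp [eq_comm]

end Commutative

section Anti

open MulOpposite

/-- The anti-automorphism fixing the generators, as a linear endomorphism. -/
def anti : Alg P →ₗ[R] Alg P :=
  (opLinearEquiv R).symm.toLinearMap ∘ₗ (starHom P).toLinearMap

variable {P}

lemma anti_mul (x y : Alg P) : anti P (x * y) = anti P y * anti P x := by
  simp [anti]

lemma anti_one : anti P 1 = 1 := by simp [anti]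

lemma anti_pow (x : Alg P) (m : ℕ) : anti P (x ^ m) = anti P x ^ m := by
  simp [anti]

lemma anti_X (i : ℕ) : anti P (Xg P i) = Xg P i := congrArg unop (starHom_pr_ι P _)

lemma anti_Xi (i : ℕ) : anti P (Xgi P i) = Xgi P i := congrArg unop (starHom_pr_ι P _)

lemma anti_E (i : ℕ) : anti P (Eg P i) = Eg P i := congrArg unop (starHom_pr_ι P _)

lemma anti_Y : anti P (Yg P) = Yg P := congrArg unop (starHom_pr_ι P _)

lemma anti_Yi : anti P (Ygi P) = Ygi P := congrArg unop (starHom_pr_ι P _)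

lemma anti_upX (m : ℕ) : anti P (upX P m) = downX P m := by
  induction m with
  | zero => exact anti_one
  | succ m ih => rw [upX, anti_mul, ih, anti_X, downX]

lemma anti_downX (m : ℕ) : anti P (downX P m) = upX P m := by
  induction m with
  | zero => exact anti_one
  | succ m ih => rw [upX, downX, anti_mul, ih, anti_X]

lemma anti_upXi (m : ℕ) : anti P (upXi P m) = downXi P m := by
  induction m with
  | zero => exact anti_one
  | succ m ih => rw [upXi, anti_mul, ih, anti_Xi, downXi]

lemma anti_downXi (m : ℕ) : anti P (downXi P m) = upXi P m := by
  induction m with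
  | zero => exact anti_one
  | succ m ih => rw [upXi, downXi, anti_mul, ih, anti_Xi]

lemma anti_Ypow (i : ℕ) (p : ℤ) : anti P (Ypow P i p) = Ypow P i p := by
  unfold Ypow
  split_ifs <;> rw [anti_pow]
  · simp only [Yp, anti_mul, anti_upX, anti_downX, anti_Y, mul_assoc]
  · simp only [YpInv, anti_mul, anti_upXi, anti_downXi, anti_Yi, mul_assoc]

lemma anti_YpowProd {m : ℕ} (hm : m ≤ P.n) (s : ℕ → ℤ) :
    anti P (YpowProd P s m) = YpowProd P s m := by
  induction m with
  | zero => exact anti_one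
  | succ m ih =>
    rw [YpowProd, anti_mul, ih (by omega), anti_Ypow]
    exact commute_YpowProd (fun j hj hjm => (commute_Ypow
      (commute_Yp_Yp hj (by omega) (by omega) hm) _).symm) s

lemma anti_jmSub {m : ℕ} (hm : m ≤ P.n) {c : Alg P} (hc : c ∈ jmSub P m) : anti P c = c :=
  jmSub_induction hm (p := fun c => anti P c = c) (anti_YpowProd hm) (map_zero _)
    (fun x y hx hy => by rw [map_add, hx, hy]) (fun r x hx => by rw [map_smul, hx]) hc

end Anti

section Main

variable {P}

lemma Xi_eq {i : ℕ} (h1 : 1 ≤ i) (h2 : i ≤ P.n - 1) :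
    Xgi P i = Xg P i - P.delta • 1 + P.delta • Eg P i := by
  have := X_sub_Xi h1 h2
  rw [smul_sub] at this
  rw [← sub_eq_zero] at this ⊢
  rw [← neg_eq_zero, ← this]
  abel

lemma X_eq {i : ℕ} (h1 : 1 ≤ i) (h2 : i ≤ P.n - 1) :
    Xg P i = Xgi P i + P.delta • 1 - P.delta • Eg P i := by
  rw [Xi_eq h1 h2]
  abel

lemma Xi_mul_E {i : ℕ} (h1 : 1 ≤ i) (h2 : i ≤ P.n - 1) :
    Xgi P i * Eg P i = P.laminv • Eg P i := by
  rw [← laminv_smul_lam_smul (Xgi P i * Eg P i), ← mul_smul_comm, ← X_mul_E h1 h2, ← mul_assoc,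
    Xi_mul_X, one_mul]

lemma X_mul_self {i : ℕ} (h1 : 1 ≤ i) (h2 : i ≤ P.n - 1) :
    Xg P i * Xg P i = 1 + P.delta • Xg P i + (-(P.delta * P.lam)) • Eg P i := by
  nth_rewrite 2 [X_eq h1 h2]
  rw [mul_sub, mul_add, X_mul_Xi, mul_smul_comm, mul_smul_comm, mul_one, X_mul_E h1 h2, smul_smul,
    sub_eq_add_neg, ← neg_smul]

lemma Xi_mul_self {i : ℕ} (h1 : 1 ≤ i) (h2 : i ≤ P.n - 1) :
    Xgi P i * Xgi P i = 1 + (-P.delta) • Xgi P i + (P.delta * P.laminv) • Eg P i := by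
  nth_rewrite 2 [Xi_eq h1 h2]
  rw [mul_add, mul_sub, Xi_mul_X, mul_smul_comm, mul_smul_comm, mul_one, Xi_mul_E h1 h2, smul_smul,
    sub_eq_add_neg]
  exact congrArg (1 + · + _) (neg_smul P.delta (Xgi P i)).symm

lemma YpInv_succ {i : ℕ} (hi : 1 ≤ i) : YpInv P (i + 1) = Xgi P i * YpInv P i * Xgi P i := by
  obtain ⟨j, rfl⟩ : ∃ j, i = j + 1 := ⟨i - 1, by omega⟩
  simp [YpInv, downXi, upXi, mul_assoc]

/-- The span appearing in the second claim, with exponent bound `N`. -/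
def boundedSpan (P : Params R) (i : ℕ) (N : ℤ) : Submodule R (Alg P) :=
  Submodule.span R {x | ∃ s : ℕ → ℤ, |s i| ≤ N ∧ x = YpowProd P s i * Eg P i}

lemma mul_Ypow_mul_E_mem {m : ℕ} (hm : m ≤ P.n) {c : Alg P} (hc : c ∈ jmSub P m) {p N : ℤ}
    (hp : |p| ≤ N) : c * Ypow P (m + 1) p * Eg P (m + 1) ∈ boundedSpan P (m + 1) N := by
  refine jmSub_induction hm (p := fun c => c * Ypow P (m + 1) p * Eg P (m + 1) ∈ _) ?_ ?_ ?_ ?_ hc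
  · intro s
    refine Submodule.subset_span ⟨Function.update s (m + 1) p, ?_, ?_⟩
    · rwa [Function.update_self]
    · rw [YpowProd_update]
  · simp
  · intro x y hx hy
    rw [add_mul, add_mul]
    exact add_mem hx hy
  · intro r x hx
    rw [smul_mul_assoc, smul_mul_assoc]
    exact Submodule.smul_mem _ _ hx

lemma mul_mem_boundedSpan {m : ℕ} {ε : ℤ} {Z : Alg P}
    (hε : |ε| ≤ 1) (hZc : ∀ j, 1 ≤ j → j ≤ m + 1 → Commute Z (Yp P j))
    (hZ : Z * Eg P (m + 1) = Ypow P (m + 1) ε * Eg P (m + 1)) {N : ℤ} {x : Alg P}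
    (hx : x ∈ boundedSpan P (m + 1) N) : Z * x ∈ boundedSpan P (m + 1) (N + 1) := by
  induction hx using Submodule.span_induction with
  | zero => simp
  | add x y _ _ hx hy => rw [mul_add]; exact add_mem hx hy
  | smul r x _ hx => rw [mul_smul_comm]; exact Submodule.smul_mem _ _ hx
  | mem x hx =>
    obtain ⟨s, hs, rfl⟩ := hx
    refine Submodule.subset_span ⟨Function.update s (m + 1) (s (m + 1) + ε), ?_, ?_⟩
    · rw [Function.update_self]
      exact (abs_add_le _ _).trans (add_le_add hs hε)
    · rw [YpowProd_update, Ypow_add, ← mul_assoc, (commute_YpowProd hZc s).eq, mul_assoc, hZ,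
        YpowProd]
      simp only [mul_assoc]

lemma commute_YpInv {x : Alg P} {i : ℕ} (h : Commute x (Yp P i)) : Commute x (YpInv P i) := by
  rw [← Ypow_neg_one]
  exact commute_Ypow h _

/-- The compression `eᵢ (Yᵢ')^p eᵢ` lands in the span of lower monomials. -/
def Compressible (P : Params R) (m : ℕ) : Prop :=
  ∀ p : ℤ, Eg P (m + 1) * Ypow P (m + 1) p * Eg P (m + 1) ∈ leftMul (jmSub P m) (Eg P (m + 1))

lemma X_mul_Ypow_mul_E_mem_nat {m : ℕ} (hm : m + 1 ≤ P.n - 1) (h : Compressible P m) (r : ℕ) :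
    Xg P (m + 1) * Ypow P (m + 1) r * Eg P (m + 1) ∈ boundedSpan P (m + 1) r ∧
      Xg P (m + 1) * Ypow P (m + 1) (-(r : ℤ)) * Eg P (m + 1) ∈ boundedSpan P (m + 1) r := by
  have hE (p : ℤ) (N : ℕ) :
      Eg P (m + 1) * Ypow P (m + 1) p * Eg P (m + 1) ∈ boundedSpan P (m + 1) N := by
    obtain ⟨c, hc, hce⟩ := mem_leftMul.1 (h p)
    have := mul_Ypow_mul_E_mem (P := P) (by omega) hc (p := 0) (N := N) (by simp)
    rwa [Ypow_zero, mul_one, hce] at this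
  have hY (p : ℤ) (N : ℕ) (hp : |p| ≤ N) :
      Ypow P (m + 1) p * Eg P (m + 1) ∈ boundedSpan P (m + 1) N := by
    have := mul_Ypow_mul_E_mem (P := P) (m := m) (by omega) (one_mem _) hp
    rwa [one_mul] at this
  have hZc (j : ℕ) (hj : 1 ≤ j) (hjm : j ≤ m + 1) : Commute (Yp P (m + 1 + 1)) (Yp P j) :=
    commute_Yp_Yp (by omega) (by omega) hj (by omega)
  induction r with
  | zero =>
    simp only [Nat.cast_zero, neg_zero, Ypow_zero, mul_one, X_mul_E (Nat.le_add_left 1 m) hm]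
    have := hY 0 0 (by simp)
    rw [Ypow_zero, one_mul] at this
    exact ⟨Submodule.smul_mem _ _ this, Submodule.smul_mem _ _ this⟩
  | succ r ih =>
    have hXi (p : ℤ) : Xgi P (m + 1) * Ypow P (m + 1) p * Eg P (m + 1) =
        Xg P (m + 1) * Ypow P (m + 1) p * Eg P (m + 1)
          - P.delta • (Ypow P (m + 1) p * Eg P (m + 1))
          + P.delta • (Eg P (m + 1) * Ypow P (m + 1) p * Eg P (m + 1)) := by
      rw [Xi_eq (Nat.le_add_left 1 m) hm]
      simp only [add_mul, sub_mul, smul_mul_assoc, one_mul]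
    have hpos : Xg P (m + 1) * Ypow P (m + 1) ((r + 1 : ℕ) : ℤ) * Eg P (m + 1) =
        Yp P (m + 1 + 1) * (Xgi P (m + 1) * Ypow P (m + 1) r * Eg P (m + 1)) := by
      rw [Yp_succ (Nat.le_add_left 1 m), Nat.cast_succ, add_comm (r : ℤ) 1, Ypow_add, Ypow_one]
      calc _ = Xg P (m + 1) * Yp P (m + 1) * 1 * Ypow P (m + 1) r * Eg P (m + 1) := by noncomm_ring
        _ = _ := by rw [← X_mul_Xi (m + 1)]; simp only [mul_assoc]
    have hneg : Xgi P (m + 1) * Ypow P (m + 1) (-((r + 1 : ℕ) : ℤ)) * Eg P (m + 1) =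
        YpInv P (m + 1 + 1) * (Xg P (m + 1) * Ypow P (m + 1) (-(r : ℤ)) * Eg P (m + 1)) := by
      rw [YpInv_succ (Nat.le_add_left 1 m), Nat.cast_succ, neg_add, add_comm (-(r : ℤ)) (-1),
        Ypow_add, Ypow_neg_one]
      calc _ = Xgi P (m + 1) * YpInv P (m + 1) * 1 * Ypow P (m + 1) (-(r : ℤ)) * Eg P (m + 1) := by
            noncomm_ring
        _ = _ := by rw [← Xi_mul_X (m + 1)]; simp only [mul_assoc]
    constructor
    · rw [hpos, Nat.cast_succ]
      refine mul_mem_boundedSpan (ε := -1) (by simp) hZc ?_ ?_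
      · rw [Yp_succ_mul_E (Nat.le_add_left 1 m) hm, Ypow_neg_one]
      · rw [hXi]
        exact add_mem (sub_mem ih.1 (Submodule.smul_mem _ _ (hY _ _ (by simp))))
          (Submodule.smul_mem _ _ (hE _ _))
    · have hX := hXi (-((r + 1 : ℕ) : ℤ))
      rw [← sub_eq_iff_eq_add, eq_comm, sub_eq_iff_eq_add] at hX
      rw [hX]
      refine add_mem (sub_mem ?_ (Submodule.smul_mem _ _ (hE _ _)))
        (Submodule.smul_mem _ _ (hY _ _ (by rw [abs_neg, Nat.abs_cast])))
      rw [hneg, Nat.cast_succ]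
      refine mul_mem_boundedSpan (ε := 1) (by simp)
        (fun j hj hjm => (commute_YpInv (hZc j hj hjm).symm).symm) ?_ ih.2
      rw [YpInv_succ_mul_E (Nat.le_add_left 1 m) hm, Ypow_one]

lemma X_mul_Ypow_mul_E_mem {m : ℕ} (hm : m + 1 ≤ P.n - 1) (h : Compressible P m) (p : ℤ) :
    Xg P (m + 1) * Ypow P (m + 1) p * Eg P (m + 1) ∈ boundedSpan P (m + 1) |p| := by
  obtain ⟨r, rfl | rfl⟩ := p.eq_nat_or_neg
  · simpa using (X_mul_Ypow_mul_E_mem_nat hm h r).1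
  · simpa using (X_mul_Ypow_mul_E_mem_nat hm h r).2

lemma boundedSpan_le_leftMul {i : ℕ} (hi : i ≤ P.n) (N : ℤ) :
    boundedSpan P i N ≤ leftMul (jmSub P i) (Eg P i) := by
  rw [leftMul_jmSub hi]
  exact Submodule.span_mono fun _ ⟨s, _, hx⟩ => ⟨s, hx⟩

lemma X_mul_mul_E_mem {m : ℕ} (hm : m + 1 ≤ P.n - 1) (h : Compressible P m) {c : Alg P}
    (hc : c ∈ jmSub P (m + 1)) :
    Xg P (m + 1) * c * Eg P (m + 1) ∈ leftMul (jmSub P (m + 1)) (Eg P (m + 1)) := by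
  refine jmSub_induction (by omega) (p := fun c => Xg P (m + 1) * c * Eg P (m + 1) ∈ _)
    ?_ ?_ ?_ ?_ hc
  · intro s
    have hX : Commute (Xg P (m + 1)) (YpowProd P s m) :=
      commute_YpowProd (fun j hj hjm => (commute_Yp_X_of_lt hj (by omega) hm).symm) s
    rw [YpowProd, ← mul_assoc, hX.eq, mul_assoc, mul_assoc, ← mul_assoc (Xg P (m + 1))]
    exact mul_mem_leftMul (jmSub_le_succ m (YpowProd_mem s m))
      (boundedSpan_le_leftMul (by omega) _ (X_mul_Ypow_mul_E_mem hm h _))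
  · simp
  · intro x y hx hy
    rw [mul_add, add_mul]
    exact add_mem hx hy
  · intro r x hx
    rw [mul_smul_comm, smul_mul_assoc]
    exact Submodule.smul_mem _ _ hx

lemma E_mul_mul_E_mem {m : ℕ} (hm : m + 1 ≤ P.n - 1) (h : Compressible P m) {c : Alg P}
    (hc : c ∈ jmSub P (m + 1)) :
    Eg P (m + 1) * c * Eg P (m + 1) ∈ leftMul (jmSub P (m + 1)) (Eg P (m + 1)) := by
  refine jmSub_induction (by omega) (p := fun c => Eg P (m + 1) * c * Eg P (m + 1) ∈ _)
    ?_ ?_ ?_ ?_ hc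
  · intro s
    have hE : Commute (Eg P (m + 1)) (YpowProd P s m) :=
      commute_YpowProd (fun j hj hjm => (commute_Yp_E_of_lt hj (by omega) hm).symm) s
    rw [YpowProd, ← mul_assoc, hE.eq, mul_assoc, mul_assoc, ← mul_assoc (Eg P (m + 1))]
    exact mul_mem_leftMul (jmSub_le_succ m (YpowProd_mem s m))
      (leftMul_mono (jmSub_le_succ m) _ (h _))
  · simp
  · intro x y hx hy
    rw [mul_add, add_mul]
    exact add_mem hx hy
  · intro r x hx
    rw [mul_smul_comm, smul_mul_assoc]
    exact Submodule.smul_mem _ _ hx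

lemma Xi_mul_mul_E_mem {m : ℕ} (hm : m + 1 ≤ P.n - 1) (h : Compressible P m) {c : Alg P}
    (hc : c ∈ jmSub P (m + 1)) :
    Xgi P (m + 1) * c * Eg P (m + 1) ∈ leftMul (jmSub P (m + 1)) (Eg P (m + 1)) := by
  rw [Xi_eq (Nat.le_add_left 1 m) hm]
  simp only [add_mul, sub_mul, smul_mul_assoc, one_mul]
  exact add_mem (sub_mem (X_mul_mul_E_mem hm h hc)
    (Submodule.smul_mem _ _ (coe_mul_mem_leftMul hc)))
    (Submodule.smul_mem _ _ (E_mul_mul_E_mem hm h hc))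

lemma exists_E_mul_eq {i : ℕ} (hi : i ≤ P.n) {X : Alg P} (hX : anti P X = X)
    (h : ∀ c ∈ jmSub P i, X * c * Eg P i ∈ leftMul (jmSub P i) (Eg P i)) :
    ∀ c ∈ jmSub P i, ∃ d ∈ jmSub P i, Eg P i * c * X = Eg P i * d := by
  intro c hc
  obtain ⟨d, hd, hde⟩ := mem_leftMul.1 (h c hc)
  refine ⟨d, hd, ?_⟩
  have := congrArg (anti P) hde
  rw [anti_mul, anti_mul, anti_mul, hX, anti_E, anti_jmSub hi hd, anti_jmSub hi hc] at this
  rw [this, mul_assoc]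

lemma compressible_succ {m : ℕ} (hm : m + 1 + 1 ≤ P.n - 1) (h : Compressible P m) :
    Compressible P (m + 1) := by
  have h1 : 1 ≤ m + 1 := Nat.le_add_left 1 m
  have h1' : 1 ≤ m + 1 + 1 := Nat.le_add_left 1 _
  have hm' : m + 1 ≤ P.n - 1 := by omega
  have hn : m + 1 ≤ P.n := by omega
  have hY : Yp P (m + 1) ∈ jmSub P (m + 1) := by
    rw [← Ypow_one]; exact Ypow_mem m 1
  have hYi : YpInv P (m + 1) ∈ jmSub P (m + 1) := by
    rw [← Ypow_neg_one]; exact Ypow_mem m (-1)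
  have hZc (j : ℕ) (hj : 1 ≤ j) (hjm : j ≤ m + 1) : Commute (Yp P (m + 1 + 1)) (Yp P j) :=
    commute_Yp_Yp (by omega) (by omega) hj (by omega)
  have hZ : ∀ c ∈ jmSub P (m + 1), Commute (Yp P (m + 1 + 1)) c :=
    fun c hc => commute_jmSub hn hZc hc
  have hZi : ∀ c ∈ jmSub P (m + 1), Commute (YpInv P (m + 1 + 1)) c := fun c hc =>
    commute_jmSub hn (fun j hj hjm => (commute_YpInv (hZc j hj hjm).symm).symm) hc
  have hE : ∀ c ∈ jmSub P (m + 1), Commute (Eg P (m + 1 + 1)) c := fun c hc =>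
    commute_jmSub hn (fun j hj hjm => (commute_Yp_E_of_lt hj (by omega) hm).symm) hc
  have hW : ∀ c ∈ jmSub P (m + 1), Commute (Xg P (m + 1 + 1)) c := fun c hc =>
    commute_jmSub hn (fun j hj hjm => (commute_Yp_X_of_lt hj (by omega) hm).symm) hc
  have hWi : ∀ c ∈ jmSub P (m + 1), Commute (Xgi P (m + 1 + 1)) c := fun c hc =>
    Commute.units_inv_left (u := Xu P (m + 1 + 1)) (hW c hc)
  have hefe := E_mul_E_mul_E_down (P := P) h1 hm
  have hWXe : Xg P (m + 1 + 1) * Xg P (m + 1) * Eg P (m + 1 + 1) =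
      Eg P (m + 1) * Eg P (m + 1 + 1) := X_mul_X_mul_E h1' hm h1 hm' (by omega)
  have hXWf : Xg P (m + 1) * Xg P (m + 1 + 1) * Eg P (m + 1) =
      Eg P (m + 1 + 1) * Eg P (m + 1) := X_mul_X_mul_E h1 hm' h1' hm (by omega)
  have heXW : Eg P (m + 1 + 1) * Xg P (m + 1) * Xg P (m + 1 + 1) =
      Eg P (m + 1 + 1) * Eg P (m + 1) := E_mul_X_mul_X h1 hm' h1' hm (by omega)
  have hXe : Xg P (m + 1) * Eg P (m + 1 + 1) =
      Xgi P (m + 1 + 1) * Eg P (m + 1) * Eg P (m + 1 + 1) := by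
    rw [mul_assoc (Xgi P _), ← hWXe, ← mul_assoc, ← mul_assoc, Xi_mul_X, one_mul]
  have heX : Eg P (m + 1 + 1) * Xg P (m + 1) =
      Eg P (m + 1 + 1) * Eg P (m + 1) * Xgi P (m + 1 + 1) := by
    rw [← heXW, mul_assoc _ _ (Xgi P _), X_mul_Xi, mul_one]
  have hXie : Xgi P (m + 1) * Eg P (m + 1 + 1) =
      Xg P (m + 1 + 1) * Eg P (m + 1) * Eg P (m + 1 + 1) :=
    calc Xgi P (m + 1) * Eg P (m + 1 + 1)
        = Xgi P (m + 1) * (Eg P (m + 1 + 1) * Eg P (m + 1) * Eg P (m + 1 + 1)) := by rw [hefe]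
      _ = Xgi P (m + 1) * (Xg P (m + 1) * Xg P (m + 1 + 1) * Eg P (m + 1) *
            Eg P (m + 1 + 1)) := by rw [hXWf]
      _ = Xg P (m + 1 + 1) * Eg P (m + 1) * Eg P (m + 1 + 1) := by
        simp only [← mul_assoc]
        rw [Xi_mul_X, one_mul]
  have heXi : Eg P (m + 1 + 1) * Xgi P (m + 1) =
      Eg P (m + 1 + 1) * Eg P (m + 1) * Xg P (m + 1 + 1) := by
    have := congrArg (anti P) hXie
    simpa only [anti_mul, anti_E, anti_X, anti_Xi, mul_assoc] using this
  intro p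
  obtain ⟨r, rfl | rfl⟩ := p.eq_nat_or_neg
  · rw [Ypow_natCast, Yp_succ h1]
    refine compress_pow_mem (X_mul_self h1 hm') hY hYi ?_ ?_
      (fun c hc => X_mul_mul_E_mem hm' h hc)
      (exists_E_mul_eq hn (anti_X _) fun c hc => X_mul_mul_E_mem hm' h hc)
      (Xi_mul_self h1' hm) hXe heX (Xi_mul_E h1' hm) hefe hE hWi
      (fun c hc => E_mul_mul_E_mem hm' h hc) (E_mul_E h1' hm) r
    · rw [← Yp_succ h1, Yp_succ_mul_E h1 hm']
    · rw [← Yp_succ h1]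
      exact hZ
  · rw [Ypow_neg_natCast, YpInv_succ h1]
    refine compress_pow_mem (Xi_mul_self h1 hm') hYi hY ?_ ?_
      (fun c hc => Xi_mul_mul_E_mem hm' h hc)
      (exists_E_mul_eq hn (anti_Xi _) fun c hc => Xi_mul_mul_E_mem hm' h hc)
      (X_mul_self h1' hm) hXie heXi (X_mul_E h1' hm) hefe hE hW
      (fun c hc => E_mul_mul_E_mem hm' h hc) (E_mul_E h1' hm) r
    · rw [← YpInv_succ h1, YpInv_succ_mul_E h1 hm']
    · rw [← YpInv_succ h1]
      exact hZi

/-- Every integral power of `Y` is a combination of `1, Y, …, Y^{k-1}`. -/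
lemma Ypow_one_mem_span (hk : 1 ≤ P.k) (hq0 : P.qc 0 = (P.q0 : R)) (p : ℤ) :
    Ypow P 1 p ∈ Submodule.span R {x | ∃ m < P.k, x = Yg P ^ m} := by
  set S := Submodule.span R {x | ∃ m < P.k, x = Yg P ^ m}
  have hpow {m : ℕ} (hm : m < P.k) : Yg P ^ m ∈ S := Submodule.subset_span ⟨m, hm, rfl⟩
  have hY : ∀ x ∈ S, Yg P * x ∈ S := by
    intro x hx
    induction hx using Submodule.span_induction with
    | zero => simp
    | add x y _ _ hx hy => rw [mul_add]; exact add_mem hx hy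
    | smul r x _ hx => rw [mul_smul_comm]; exact Submodule.smul_mem _ _ hx
    | mem x hx =>
      obtain ⟨m, hm, rfl⟩ := hx
      rw [← pow_succ']
      rcases (Nat.succ_le_of_lt hm).lt_or_eq with h | h
      · exact hpow h
      · rw [← Nat.succ_eq_add_one, h, Y_pow_k]
        exact sum_mem fun i hi => Submodule.smul_mem _ _ (hpow (Finset.mem_range.1 hi))
  have hYi_pow (m : ℕ) : Ygi P * Yg P ^ (m + 1) = Yg P ^ m := by
    rw [pow_succ', ← mul_assoc, Yi_mul_Y, one_mul]
  have hYi_one : Ygi P ∈ S := by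
    obtain ⟨l, hl⟩ : ∃ l, P.k = l + 1 := ⟨P.k - 1, by omega⟩
    have h := congrArg (Ygi P * ·) (Y_pow_k (P := P))
    simp only [hl, Finset.sum_range_succ', mul_add, Finset.mul_sum, mul_smul_comm, hYi_pow,
      pow_zero, mul_one, hq0] at h
    have h2 : (P.q0 : R) • Ygi P ∈ S := by
      rw [← sub_eq_iff_eq_add'] at h
      rw [← h]
      exact sub_mem (hpow (by omega)) (sum_mem fun i hi =>
        Submodule.smul_mem _ _ (hpow (by have := Finset.mem_range.1 hi; omega)))
    have h3 := S.smul_mem ((P.q0⁻¹ : Rˣ) : R) h2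
    rwa [smul_smul, Units.inv_mul, one_smul] at h3
  have hYi : ∀ x ∈ S, Ygi P * x ∈ S := by
    intro x hx
    induction hx using Submodule.span_induction with
    | zero => simp
    | add x y _ _ hx hy => rw [mul_add]; exact add_mem hx hy
    | smul r x _ hx => rw [mul_smul_comm]; exact Submodule.smul_mem _ _ hx
    | mem x hx =>
      obtain ⟨m, hm, rfl⟩ := hx
      rcases m with _ | m
      · rwa [pow_zero, mul_one]
      · rw [hYi_pow]
        exact hpow (by omega)
  obtain ⟨r, rfl | rfl⟩ := p.eq_nat_or_neg
  · rw [Ypow_natCast, Yp_one]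
    induction r with
    | zero => exact hpow hk
    | succ r ih => rw [pow_succ']; exact hY _ ih
  · rw [Ypow_neg_natCast]
    have hone : YpInv P 1 = Ygi P := by simp [YpInv, downXi, upXi]
    rw [hone]
    induction r with
    | zero => simpa using hpow (m := 0) hk
    | succ r ih => rw [pow_succ']; exact hYi _ ih

lemma compressible_zero (hk : 1 ≤ P.k) (hq0 : P.qc 0 = (P.q0 : R)) (hn : 1 ≤ P.n - 1) :
    Compressible P 0 := by
  intro p
  have h := Ypow_one_mem_span hk hq0 p
  rw [zero_add]
  generalize Ypow P 1 p = y at h ⊢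
  induction h using Submodule.span_induction with
  | zero => simp
  | add x y _ _ hx hy => rw [mul_add, add_mul]; exact add_mem hx hy
  | smul r x _ hx =>
    rw [mul_smul_comm, smul_mul_assoc]; exact Submodule.smul_mem _ _ hx
  | mem x hx =>
    obtain ⟨m, hm, rfl⟩ := hx
    rw [E_Y_pow_E (by omega) (by omega)]
    exact Submodule.smul_mem _ _ (mem_leftMul.2 ⟨1, one_mem _, one_mul _⟩)

lemma compressible (hk : 1 ≤ P.k) (hq0 : P.qc 0 = (P.q0 : R)) {m : ℕ} (hm : m + 1 ≤ P.n - 1) :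
    Compressible P m := by
  induction m with
  | zero => exact compressible_zero hk hq0 hm
  | succ m ih => exact compressible_succ hm (ih (by omega))

lemma anti_mem_of_mem_boundedSpan {i : ℕ} (hi : i ≤ P.n) {N : ℤ} {x : Alg P}
    (hx : x ∈ boundedSpan P i N) :
    anti P x ∈ Submodule.span R {x | ∃ s : ℕ → ℤ, |s i| ≤ N ∧ x = Eg P i * YpowProd P s i} := by
  induction hx using Submodule.span_induction with
  | zero => simp
  | add x y _ _ hx hy => rw [map_add]; exact add_mem hx hy
  | smul r x _ hx => rw [map_smul]; exact Submodule.smul_mem _ _ hx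
  | mem x hx =>
    obtain ⟨s, hs, rfl⟩ := hx
    refine Submodule.subset_span ⟨s, hs, ?_⟩
    rw [anti_mul, anti_E, anti_YpowProd hi]

end Main

end CBMW

open CBMW

/-- For every integer `p` and `1 ≤ i ≤ n-1`:
(I) `eᵢ(Yᵢ')^p eᵢ ∈ ⟨Y^{s₁}(Y₂')^{s₂}⋯(Y_{i-1}')^{s_{i-1}} eᵢ⟩`;
(II) `Xᵢ(Yᵢ')^p eᵢ ∈ ⟨Y^{s₁}⋯(Yᵢ')^{sᵢ} eᵢ : |sᵢ| ≤ |p|⟩`;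
(III) `eᵢ(Yᵢ')^p Xᵢ ∈ ⟨eᵢ Y^{s₁}⋯(Yᵢ')^{sᵢ} : |sᵢ| ≤ |p|⟩`. -/
theorem statement5 {R : Type} [CommRing R] (P : Params R)
    (hn : 1 ≤ P.n) (hk : 1 ≤ P.k) (hq0 : P.qc 0 = (P.q0 : R))
    (hcomp : (P.lam : R) - P.laminv = P.delta * (1 - P.A 0)) :
    ∀ (p : ℤ) (i : ℕ), 1 ≤ i → i ≤ P.n - 1 →
      (Eg P i * Ypow P i p * Eg P i ∈
        Submodule.span R {x : Alg P | ∃ s : ℕ → ℤ, x = YpowProd P s (i - 1) * Eg P i}) ∧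
      (Xg P i * Ypow P i p * Eg P i ∈
        Submodule.span R
          {x : Alg P | ∃ s : ℕ → ℤ, |s i| ≤ |p| ∧ x = YpowProd P s i * Eg P i}) ∧
      (Eg P i * Ypow P i p * Xg P i ∈
        Submodule.span R
          {x : Alg P | ∃ s : ℕ → ℤ, |s i| ≤ |p| ∧ x = Eg P i * YpowProd P s i}) := by
  intro p i hi hin
  obtain ⟨m, rfl⟩ : ∃ m, i = m + 1 := ⟨i - 1, by omega⟩
  have hc := compressible hk hq0 hin
  have hX := X_mul_Ypow_mul_E_mem hin hc p
  refine ⟨?_, hX, ?_⟩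
  · have h := hc p
    rwa [leftMul_jmSub (by omega)] at h
  · have h := anti_mem_of_mem_boundedSpan (by omega) hX
    rwa [anti_mul, anti_mul, anti_E, anti_X, anti_Ypow, ← mul_assoc] at h
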